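/- Let n ≥ 3 and let F be an odd-cycle-agreeing family of subgraphs of K_n, with F̂ the Fourier transform of its indicator function. Then for every i ∈ ℕ, Σ_{G⊆E_n} (−1)^(|G|)·q_i(G)·F̂(G)² = 0, and for every graph R that is a subgraph of some complete bipartite graph, Σ_{G⊆E_n} (−1)^(|G|)·q_R(G)·F̂(G)² = 0, where q_R(G) is the probability that a uniformly random cut of G is isomorphic (as a graph) to R. -/

import Mathlib

open scoped Classical

/-- The edge set of the complete graph `K_n` on vertex set `Fin n`:
all non-diagonal unordered pairs. -/
def edgeFinset (n : ℕ) : Finset (Sym2 (Fin n)) :=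
  Finset.univ.filter (fun e => ¬ e.IsDiag)

/-- The simple graph on `Fin n` with edge set `G`. -/
def graphOf {n : ℕ} (G : Finset (Sym2 (Fin n))) : SimpleGraph (Fin n) :=
  SimpleGraph.fromEdgeSet (G : Set (Sym2 (Fin n)))

/-- The graph `G` contains a cycle of odd length. -/
def HasOddCycle {n : ℕ} (G : Finset (Sym2 (Fin n))) : Prop :=
  ∃ (v : Fin n) (w : (graphOf G).Walk v v), w.IsCycle ∧ Odd w.length

/-- A family of graphs is odd-cycle-agreeing if for any two members `G, H`,
the complement (within `E_n`) of the symmetric difference `G Δ H` contains an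
odd cycle. -/
def OddCycleAgreeing (n : ℕ) (F : Finset (Finset (Sym2 (Fin n)))) : Prop :=
  ∀ G ∈ F, ∀ H ∈ F, HasOddCycle (edgeFinset n \ ((G \ H) ∪ (H \ G)))

/-- The cut of `G` determined by a two-colouring `c` of the vertices:
the set of edges of `G` with differently-coloured endpoints. -/
def cutOf {n : ℕ} (c : Fin n → Bool) (G : Finset (Sym2 (Fin n))) :
    Finset (Sym2 (Fin n)) :=
  G.filter fun e =>
    Sym2.lift ⟨fun i j => xor (c i) (c j), fun i j => Bool.xor_comm _ _⟩ e = true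

/-- `q_k(G)`: the probability, over a uniformly random `c : [n] → {0,1}`,
that the cut of `G` determined by `c` has exactly `k` edges. -/
noncomputable def qk (n : ℕ) (k : ℕ) (G : Finset (Sym2 (Fin n))) : ℝ :=
  ((Finset.univ.filter
      (fun c : Fin n → Bool => (cutOf c G).card = k)).card : ℝ) / 2 ^ n

/-- Two graphs on `[n]` are isomorphic if some permutation of the vertices
maps the edge set of one onto the other. -/
def GraphIso {n : ℕ} (A R : Finset (Sym2 (Fin n))) : Prop :=
  ∃ σ : Equiv.Perm (Fin n), A.image (Sym2.map σ) = R

/-- `q_R(G)`: the probability, over a uniformly random `c : [n] → {0,1}`,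
that the cut of `G` determined by `c` is isomorphic to `R`. -/
noncomputable def qR (n : ℕ) (R G : Finset (Sym2 (Fin n))) : ℝ :=
  ((Finset.univ.filter
      (fun c : Fin n → Bool => GraphIso (cutOf c G) R)).card : ℝ) / 2 ^ n

/-- The Fourier coefficient, at `R ⊆ E_n`, of the indicator function of a
family `F` of subgraphs of `K_n`. -/
noncomputable def famHat {n : ℕ} (F : Finset (Finset (Sym2 (Fin n))))
    (R : Finset (Sym2 (Fin n))) : ℝ :=
  (∑ S ∈ (edgeFinset n).powerset,
      (if S ∈ F then (1 : ℝ) else 0) * (-1 : ℝ) ^ (R ∩ S).card) /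
    2 ^ ((edgeFinset n).card)

/-- A graph containing an odd cycle has an edge inside a colour class of any two-colouring. -/
lemma HasOddCycle.exists_monochromatic {n : ℕ} {G : Finset (Sym2 (Fin n))}
    (h : HasOddCycle G) (c : Fin n → Bool) : ∃ i j : Fin n, s(i, j) ∈ G ∧ c i = c j := by
  obtain ⟨v, w, -, hodd⟩ := h
  by_contra! hc
  let C : (graphOf G).Coloring Bool := SimpleGraph.Coloring.mk c fun {i j} hij =>
    hc i j (by simpa using ((SimpleGraph.fromEdgeSet_adj _).mp hij).1)
  exact Nat.not_even_iff_odd.mpr hodd ((C.even_length_iff_congr w).mpr Iff.rfl)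

/-- Adding or removing a monochromatic edge does not change a cut. -/
lemma cutOf_symmDiff_singleton {n : ℕ} {c : Fin n → Bool} {i j : Fin n} (hij : c i = c j)
    (G : Finset (Sym2 (Fin n))) : cutOf c (symmDiff G {s(i, j)}) = cutOf c G := by
  ext e
  by_cases he : e = s(i, j)
  · subst he
    simp [cutOf, hij]
  · simp [cutOf, Finset.mem_symmDiff, he]

lemma neg_one_pow_card_symmDiff_singleton {α : Type*} [DecidableEq α] (G : Finset α) (e : α) :
    (-1 : ℝ) ^ (symmDiff G {e}).card = -(-1) ^ G.card := by
  by_cases he : e ∈ G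
  · have h : symmDiff G {e} = G.erase e := by
      ext x
      by_cases hx : x = e <;> simp [Finset.mem_symmDiff, hx, he]
    rw [h, ← Finset.card_erase_add_one he, pow_succ]
    ring
  · have h : symmDiff G {e} = insert e G := by
      ext x
      by_cases hx : x = e <;> simp [Finset.mem_symmDiff, hx, he]
    rw [h, Finset.card_insert_of_notMem he, pow_succ]
    ring

lemma neg_one_pow_card_symmDiff_singleton_inter {α : Type*} [DecidableEq α] (G S : Finset α)
    (e : α) : (-1 : ℝ) ^ (symmDiff G {e} ∩ S).card =
      (if e ∈ S then -1 else 1) * (-1) ^ (G ∩ S).card := by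
  split_ifs with he
  · have h : symmDiff G {e} ∩ S = symmDiff (G ∩ S) {e} := by
      ext x
      by_cases hx : x = e <;> simp [Finset.mem_symmDiff, hx, he]
    rw [h, neg_one_pow_card_symmDiff_singleton]
    ring
  · have h : symmDiff G {e} ∩ S = G ∩ S := by
      ext x
      by_cases hx : x = e <;> simp [Finset.mem_symmDiff, hx, he]
    rw [h, one_mul]

/-- If `S` and `T` agree on an odd cycle, then `χ_S χ_T` is orthogonal to every function
`(-1)^|G| φ(G)` with `φ(G)` depending only on the cut of `G` by a fixed colouring. -/
lemma sum_cut_mul_characters_eq_zero {n : ℕ} {S T : Finset (Sym2 (Fin n))}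
    (h : HasOddCycle (edgeFinset n \ ((S \ T) ∪ (T \ S)))) (c : Fin n → Bool)
    (φ : Finset (Sym2 (Fin n)) → ℝ) :
    ∑ G ∈ (edgeFinset n).powerset,
      (-1 : ℝ) ^ G.card * φ (cutOf c G) * ((-1) ^ (G ∩ S).card * (-1) ^ (G ∩ T).card) = 0 := by
  obtain ⟨i, j, hmem, hij⟩ := h.exists_monochromatic c
  simp only [Finset.mem_sdiff, Finset.mem_union, not_or, not_and, not_not] at hmem
  obtain ⟨hE, hST, hTS⟩ := hmem
  refine Finset.sum_involution (fun G _ => symmDiff G {s(i, j)}) ?_ ?_ ?_ ?_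
  · intro G _
    rw [cutOf_symmDiff_singleton hij, neg_one_pow_card_symmDiff_singleton,
      neg_one_pow_card_symmDiff_singleton_inter, neg_one_pow_card_symmDiff_singleton_inter]
    by_cases hS : s(i, j) ∈ S
    · simp only [hS, hST hS, if_true]
      ring
    · simp only [hS, mt hTS hS, if_false]
      ring
  · intro G _ _ hG
    have := congrArg (s(i, j) ∈ ·) hG
    simp [Finset.mem_symmDiff] at this
  · intro G hG
    rw [Finset.mem_powerset] at hG ⊢
    intro x hx
    rcases Finset.mem_symmDiff.mp hx with hx | hx
    · exact hG hx.1
    · exact Finset.mem_singleton.mp hx.1 ▸ hE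
  · intro G _
    exact symmDiff_symmDiff_cancel_right _ _

lemma OddCycleAgreeing.sum_cut_mul_famHat_sq_eq_zero {n : ℕ}
    {F : Finset (Finset (Sym2 (Fin n)))} (hF : OddCycleAgreeing n F) (c : Fin n → Bool)
    (φ : Finset (Sym2 (Fin n)) → ℝ) :
    ∑ G ∈ (edgeFinset n).powerset,
      (-1 : ℝ) ^ G.card * φ (cutOf c G) * famHat F G ^ 2 = 0 := by
  simp only [famHat, ite_mul, one_mul, zero_mul, Finset.sum_ite_mem, div_pow, ← mul_div_assoc]
  rw [← Finset.sum_div, div_eq_zero_iff]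
  left
  simp only [sq, Finset.sum_mul_sum]
  simp only [Finset.mul_sum]
  rw [Finset.sum_comm]
  refine Finset.sum_eq_zero fun S hS => ?_
  rw [Finset.sum_comm]
  exact Finset.sum_eq_zero fun T hT => sum_cut_mul_characters_eq_zero
    (hF S (Finset.mem_inter.mp hS).2 T (Finset.mem_inter.mp hT).2) c φ

lemma OddCycleAgreeing.sum_cutProb_mul_famHat_sq_eq_zero {n : ℕ}
    {F : Finset (Finset (Sym2 (Fin n)))} (hF : OddCycleAgreeing n F)
    (P : Finset (Sym2 (Fin n)) → Prop) [DecidablePred P] :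
    ∑ G ∈ (edgeFinset n).powerset, (-1 : ℝ) ^ G.card *
      (((Finset.univ.filter (fun c : Fin n → Bool => P (cutOf c G))).card : ℝ) / 2 ^ n) *
        famHat F G ^ 2 = 0 := by
  simp only [Finset.card_filter, Nat.cast_sum, Finset.sum_div, Finset.mul_sum, Finset.sum_mul]
  rw [Finset.sum_comm]
  exact Finset.sum_eq_zero fun c _ => hF.sum_cut_mul_famHat_sq_eq_zero c
    fun A => ((if P A then 1 else 0 : ℕ) : ℝ) / 2 ^ n

theorem occ_spectrum_orthogonality
    (n : ℕ) (hn : 3 ≤ n)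
    (F : Finset (Finset (Sym2 (Fin n))))
    (hF : F ⊆ (edgeFinset n).powerset)
    (hAgr : OddCycleAgreeing n F) :
    (∀ i : ℕ,
      ∑ G ∈ (edgeFinset n).powerset,
        (-1 : ℝ) ^ G.card * qk n i G * (famHat F G) ^ 2 = 0) ∧
    (∀ R : Finset (Sym2 (Fin n)), R ⊆ edgeFinset n →
      (∃ c : Fin n → Bool, ∀ i j : Fin n, s(i, j) ∈ R → c i ≠ c j) →
      ∑ G ∈ (edgeFinset n).powerset,
        (-1 : ℝ) ^ G.card * qR n R G * (famHat F G) ^ 2 = 0) := by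
  exact ⟨fun i => hAgr.sum_cutProb_mul_famHat_sq_eq_zero fun A => A.card = i,
    fun R _ _ => hAgr.sum_cutProb_mul_famHat_sq_eq_zero fun A => GraphIso A R⟩
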